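/- arXiv:1607.02983 — 2 statements merged into one kernel-verified Lean document; each statement's English description precedes it below -/
import Mathlib

section
/- For all nonzero complex λ and μ, the Bazhanov–Stroganov Lax operator satisfies the 6-vertex Yang–Baxter equation on ℂ²⊗ℂ²⊗ℂ^p: R₁₂(λ/μ)·L₁(λ)·L₂(μ) = L₂(μ)·L₁(λ)·R₁₂(λ/μ), where R₁₂(λ) = R(λ)⊗Id_{ℂ^p}, L₁(λ) denotes L(λ) acting on the first ℂ² factor and on ℂ^p, and L₂(μ) denotes L(μ) acting on the second ℂ² factor and on ℂ^p. -/
open Matrix Polynomial Filter Topology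

noncomputable section

namespace SixV

/-- the local space index set `ℤ/(2l+1)ℤ` -/
abbrev Zp (l : ℕ) := ZMod (2 * l + 1)

/-- index set of the quantum space `H = (ℂ^p)^{⊗N}` -/
abbrev HIdx (l N : ℕ) := Fin N → Zp l

/-- operators on the quantum space `H` -/
abbrev Op (l N : ℕ) := Matrix (HIdx l N) (HIdx l N) ℂ

/-- clock matrix `v`, `v|k⟩ = q^k |k⟩` -/
def vM (l : ℕ) (q : ℂ) : Matrix (Zp l) (Zp l) ℂ := Matrix.diagonal fun k => q ^ k.val

def vMinv (l : ℕ) (q : ℂ) : Matrix (Zp l) (Zp l) ℂ := Matrix.diagonal fun k => (q ^ k.val)⁻¹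

/-- shift matrix `u`, `u|k⟩ = |k-1⟩` -/
def uM (l : ℕ) : Matrix (Zp l) (Zp l) ℂ := Matrix.of fun j k => if j = k - 1 then (1 : ℂ) else 0

def uMinv (l : ℕ) : Matrix (Zp l) (Zp l) ℂ := Matrix.of fun j k => if j = k + 1 then (1 : ℂ) else 0

/-- the Bazhanov-Stroganov Lax operator, a `2×2` matrix of `p×p` matrices;
`s` denotes the fixed square root `q^{1/2}` of `q`. -/
def laxM (l : ℕ) (q s pα pβ pa pb pc pd lam : ℂ) :
    Matrix (Fin 2) (Fin 2) (Matrix (Zp l) (Zp l) ℂ) :=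
  Matrix.of
    ![![(lam * pα) • vM l q - (pβ / lam) • vMinv l q,
        uM l * ((pa / s) • vM l q + (s * pb) • vMinv l q)],
      ![uMinv l * ((s * pc) • vM l q + (pd / s) • vMinv l q),
        (pa * pc / pα / lam) • vM l q - (pb * pd / pβ * lam) • vMinv l q]]

/-- the bulk parameters `α_n, β_n, a_n, b_n, c_n, d_n` of the `N`-site chain -/
structure BulkParams (N : ℕ) where
  α : Fin N → ℂ
  β : Fin N → ℂ
  a : Fin N → ℂ
  b : Fin N → ℂ
  c : Fin N → ℂ
  d : Fin N → ℂ

def BulkParams.NonZero {N : ℕ} (P : BulkParams N) : Prop :=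
  ∀ n, P.α n ≠ 0 ∧ P.β n ≠ 0 ∧ P.a n ≠ 0 ∧ P.b n ≠ 0 ∧ P.c n ≠ 0 ∧ P.d n ≠ 0

/-- embedding of a one-site operator at site `n` of the chain -/
def site (l N : ℕ) (n : Fin N) (A : Matrix (Zp l) (Zp l) ℂ) : Op l N :=
  Matrix.of fun x y =>
    A (x n) (y n) * ∏ m ∈ Finset.univ.erase n, (if x m = y m then (1 : ℂ) else 0)

def laxSite (l N : ℕ) (q s : ℂ) (P : BulkParams N) (n : Fin N) (lam : ℂ) :
    Matrix (Fin 2) (Fin 2) (Op l N) :=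
  Matrix.of fun i j =>
    site l N n (laxM l q s (P.α n) (P.β n) (P.a n) (P.b n) (P.c n) (P.d n) lam i j)

/-- bulk monodromy matrix `M(λ) = L_N(λ q^{-1/2}) ⋯ L_1(λ q^{-1/2})` -/
def mono (l N : ℕ) (q s : ℂ) (P : BulkParams N) (lam : ℂ) :
    Matrix (Fin 2) (Fin 2) (Op l N) :=
  (((List.finRange N).reverse).map fun n => laxSite l N q s P n (lam / s)).prod

/-- boundary parameters `(ζ, κ, τ)` -/
structure Bdry where
  ζ : ℂ
  κ : ℂ
  τ : ℂ

/-- the general scalar solution `K(λ; ζ, κ, τ)` of the reflection equation -/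
def kM (q s : ℂ) (B : Bdry) (lam : ℂ) : Matrix (Fin 2) (Fin 2) ℂ :=
  (B.ζ - B.ζ⁻¹)⁻¹ •
    Matrix.of
      ![![lam * B.ζ / s - s / (lam * B.ζ), B.κ * Complex.exp B.τ * (lam ^ 2 / q - q / lam ^ 2)],
        ![B.κ * Complex.exp (-B.τ) * (lam ^ 2 / q - q / lam ^ 2),
          s * B.ζ / lam - lam / (B.ζ * s)]]

/-- lift of a scalar `2×2` matrix to a `2×2` matrix of operators on `H` -/
def lift2 (l N : ℕ) (K : Matrix (Fin 2) (Fin 2) ℂ) : Matrix (Fin 2) (Fin 2) (Op l N) :=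
  Matrix.of fun i j => K i j • (1 : Op l N)

/-- the Pauli matrix `σ^y` acting on the auxiliary space -/
def sigY (l N : ℕ) : Matrix (Fin 2) (Fin 2) (Op l N) :=
  Matrix.of ![![0, (-Complex.I) • (1 : Op l N)], ![Complex.I • (1 : Op l N), 0]]

/-- `M̂(λ) = (-1)^N σ^y M(1/λ)^{t_a} σ^y` (transposition in the auxiliary indices only) -/
def mHat (l N : ℕ) (q s : ℂ) (P : BulkParams N) (lam : ℂ) :
    Matrix (Fin 2) (Fin 2) (Op l N) :=
  ((-1 : ℂ) ^ N) • (sigY l N * (mono l N q s P lam⁻¹).transpose * sigY l N)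

/-- the boundary monodromy matrix `U_-(λ) = M(λ) K_-(λ) M̂(λ)` -/
def uBdry (l N : ℕ) (q s : ℂ) (P : BulkParams N) (Bm : Bdry) (lam : ℂ) :
    Matrix (Fin 2) (Fin 2) (Op l N) :=
  mono l N q s P lam * lift2 l N (kM q s Bm lam) * mHat l N q s P lam

def opA (l N : ℕ) (q s : ℂ) (P : BulkParams N) (Bm : Bdry) (lam : ℂ) : Op l N :=
  uBdry l N q s P Bm lam 0 0
def opB (l N : ℕ) (q s : ℂ) (P : BulkParams N) (Bm : Bdry) (lam : ℂ) : Op l N :=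
  uBdry l N q s P Bm lam 0 1
def opC (l N : ℕ) (q s : ℂ) (P : BulkParams N) (Bm : Bdry) (lam : ℂ) : Op l N :=
  uBdry l N q s P Bm lam 1 0
def opD (l N : ℕ) (q s : ℂ) (P : BulkParams N) (Bm : Bdry) (lam : ℂ) : Op l N :=
  uBdry l N q s P Bm lam 1 1

/-- transfer matrix with the general boundary matrix `K_+(λ) = K(λq; ζ_+, κ_+, τ_+)` -/
def transferGen (l N : ℕ) (q s : ℂ) (P : BulkParams N) (Bp Bm : Bdry) (lam : ℂ) : Op l N :=
  (lift2 l N (kM q s Bp (lam * q)) * uBdry l N q s P Bm lam).trace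

/-- the upper-triangular `K_+` boundary matrix: `K(λq; ζ_+, κ_+, τ_+)` with `(1,2)` entry `0` -/
def kTriPlus (q s : ℂ) (B : Bdry) (lam : ℂ) : Matrix (Fin 2) (Fin 2) ℂ :=
  Matrix.of ![![kM q s B (lam * q) 0 0, 0], ![kM q s B (lam * q) 1 0, kM q s B (lam * q) 1 1]]

/-- transfer matrix with triangular `K_+` -/
def transferTri (l N : ℕ) (q s : ℂ) (P : BulkParams N) (Bp Bm : Bdry) (lam : ℂ) : Op l N :=
  (lift2 l N (kTriPlus q s Bp lam) * uBdry l N q s P Bm lam).trace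

/-- the scalar value `d_q M(λ)` of the bulk quantum determinant -/
def dqM (N : ℕ) (q : ℂ) (P : BulkParams N) (lam : ℂ) : ℂ :=
  (-q) ^ N * ∏ n, (P.β n * P.a n * P.c n / P.α n *
    (lam⁻¹ + q⁻¹ * P.b n * P.α n * lam / (P.a n * P.β n)) *
    (lam⁻¹ + q⁻¹ * P.d n * P.α n * lam / (P.c n * P.β n)))

/-- the bulk function `a(λ)` -/
def aBulk (N : ℕ) (q a0 : ℂ) (P : BulkParams N) (lam : ℂ) : ℂ :=
  a0 * ∏ n, (P.β n / lam + q⁻¹ * P.b n * P.α n * lam / P.a n)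

/-- the bulk function `d(λ)` -/
def dBulk (N : ℕ) (q a0 : ℂ) (P : BulkParams N) (lam : ℂ) : ℂ :=
  ((-1 : ℂ) ^ N / a0) *
    ∏ n, (P.a n * P.c n / P.α n * (lam⁻¹ + q * P.d n * P.α n * lam / (P.c n * P.β n)))

/-- the boundary function `g_-(λ)` -/
def gMin (s αm βm lam : ℂ) : ℂ :=
  (lam * αm / s - s / (lam * αm)) * (lam * βm / s + s / (lam * βm)) /
    ((αm - αm⁻¹) * (βm + βm⁻¹))

/-- the function `𝖠_-(λ) = g_-(λ) a(λ q^{-1/2}) d(q^{-1/2} λ^{-1})` -/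
def AAm (N : ℕ) (q s a0 αm βm : ℂ) (P : BulkParams N) (lam : ℂ) : ℂ :=
  gMin s αm βm lam * aBulk N q a0 P (lam / s) * dBulk N q a0 P (s * lam)⁻¹

/-- `a_0 = (-q)^N ∏_n q^{-j_n}` -/
def a0def (N : ℕ) (q : ℂ) (j : Fin N → ℕ) : ℂ := (-q) ^ N * ∏ n, (q ^ (j n))⁻¹

/-- the coefficient `𝖺_+(λ)` -/
def aPl (q s ζp lam : ℂ) : ℂ :=
  (lam ^ 2 * q - 1 / (q * lam ^ 2)) * (lam * ζp / s - s / (lam * ζp)) /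
    ((lam ^ 2 - 1 / lam ^ 2) * (ζp - ζp⁻¹))

/-- the coefficient `𝖽_+(λ)` -/
def dPl (q s ζp lam : ℂ) : ℂ :=
  (lam ^ 2 * q - 1 / (q * lam ^ 2)) * (ζp * s / lam - lam / (s * ζp)) /
    ((lam ^ 2 - 1 / lam ^ 2) * (ζp - ζp⁻¹))

/-- the function `k(λ)` -/
def kFun (q lam : ℂ) : ℂ := (lam ^ 2 - 1 / lam ^ 2) / (lam ^ 2 / q ^ 2 - q ^ 2 / lam ^ 2)

/-- the separation points `ξ_n^{(h)} = μ_{n,+} q^{h+1/2}` -/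
def xiP (N : ℕ) (q s : ℂ) (muP : Fin N → ℂ) (n : Fin N) (h : ℕ) : ℂ := muP n * q ^ h * s

/-- `X_n^{(h)} = (ξ_n^{(h)})^2 + (ξ_n^{(h)})^{-2}` -/
def XVal (N : ℕ) (q s : ℂ) (muP : Fin N → ℂ) (n : Fin N) (h : ℕ) : ℂ :=
  (xiP N q s muP n h) ^ 2 + ((xiP N q s muP n h) ^ 2)⁻¹

/-- the `B_-`-eigenvalue function `b_h(λ)` -/
def bEig (N : ℕ) (q s : ℂ) (Bm : Bdry) (P : BulkParams N) (muP : Fin N → ℂ)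
    (h : Fin N → ℕ) (lam : ℂ) : ℂ :=
  Bm.κ * Complex.exp Bm.τ * ((lam ^ 2 / q - q / lam ^ 2) / (Bm.ζ - Bm.ζ⁻¹)) *
    ∏ n, (P.α n * P.β n *
      (lam / xiP N q s muP n (h n) - xiP N q s muP n (h n) / lam) *
      ((lam * xiP N q s muP n (h n))⁻¹ - lam * xiP N q s muP n (h n)))

/-- the reference covector `⟨Ω| = ⊗_n ⟨j_n - 1|` -/
def refL (l N : ℕ) (j : Fin N → ℕ) : HIdx l N → ℂ :=
  fun x => ∏ n, (if x n = (j n : Zp l) - 1 then (1 : ℂ) else 0)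

/-- the reference vector `|Ω̄⟩ = ⊗_n |j_n⟩` -/
def refR (l N : ℕ) (j : Fin N → ℕ) : HIdx l N → ℂ :=
  fun x => ∏ n, (if x n = (j n : Zp l) then (1 : ℂ) else 0)

/-- the operator `∏_n ∏_{k=1}^{h_n} A_-(1/ξ_n^{(k-1)}) / 𝖠_-(1/ξ_n^{(k-1)})` -/
def leftOp (l N : ℕ) (q s a0 αm βm : ℂ) (P : BulkParams N) (Bm : Bdry) (muP : Fin N → ℂ)
    (h : Fin N → ℕ) : Op l N :=
  ((List.finRange N).map fun n =>
    (((List.range (h n)).map fun k =>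
      (AAm N q s a0 αm βm P ((xiP N q s muP n k)⁻¹))⁻¹ •
        opA l N q s P Bm ((xiP N q s muP n k)⁻¹)).prod)).prod

/-- the left SoV covector `⟨h|` -/
def leftSoV (l N : ℕ) (q s a0 αm βm : ℂ) (P : BulkParams N) (Bm : Bdry) (muP : Fin N → ℂ)
    (j h : Fin N → ℕ) : HIdx l N → ℂ :=
  Matrix.vecMul (refL l N j) (leftOp l N q s a0 αm βm P Bm muP h)

/-- the operator `∏_n ∏_{k=h_n}^{p-2} D_-(ξ_n^{(k+1)})/(k(ξ_n^{(k+1)}) 𝖠_-(1/ξ_n^{(k)}))` -/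
def rightOp (l N : ℕ) (q s a0 αm βm : ℂ) (P : BulkParams N) (Bm : Bdry) (muP : Fin N → ℂ)
    (h : Fin N → ℕ) : Op l N :=
  ((List.finRange N).map fun n =>
    (((List.range' (h n) (2 * l - h n)).map fun k =>
      (kFun q (xiP N q s muP n (k + 1)) * AAm N q s a0 αm βm P ((xiP N q s muP n k)⁻¹))⁻¹ •
        opD l N q s P Bm (xiP N q s muP n (k + 1))).prod)).prod

/-- the right SoV vector `|h⟩` -/
def rightSoV (l N : ℕ) (q s a0 αm βm : ℂ) (P : BulkParams N) (Bm : Bdry) (muP : Fin N → ℂ)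
    (j h : Fin N → ℕ) : HIdx l N → ℂ :=
  Matrix.mulVec (rightOp l N q s a0 αm βm P Bm muP h) (refR l N j)

/-- the condition (E-SOV) -/
def ESOV (N p : ℕ) (muP : Fin N → ℂ) : Prop :=
  ∀ n m : Fin N, n ≠ m → (muP n) ^ p ≠ (muP m) ^ p

/-- the condition (SoV-2) -/
def SOV2 (N l : ℕ) (q αm βm : ℂ) (muP muM : Fin N → ℂ) : Prop :=
  (∀ n, (muP n) ^ (2 * (2 * l + 1)) ≠ 1 ∧ (muP n) ^ (2 * (2 * l + 1)) ≠ -1) ∧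
  (∀ ε : ℤ, ε = 1 ∨ ε = -1 → ∀ h : ℕ, 1 ≤ h → h ≤ 2 * l → ∀ n m : Fin N,
    (muP n) ^ 2 ≠ q ^ (-2 * (h : ℤ)) * αm ^ (2 * ε) ∧
    (muP n) ^ 2 ≠ -(q ^ (-2 * (h : ℤ)) * βm ^ (2 * ε)) ∧
    (muP n) ^ 2 ≠ q ^ (-2 * ε - 2 * (h : ℤ)) * (muM m) ^ (2 * ε))

/-- the condition (cond-simple) -/
def CondSimple (N l : ℕ) (q ζp : ℂ) (muP : Fin N → ℂ) : Prop :=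
  ∀ h : ℕ, 1 ≤ h → h ≤ 2 * l → ∀ n : Fin N,
    (muP n) ^ 2 ≠ q ^ (-2 * (h : ℤ)) * ζp ^ 2 ∧
    (muP n) ^ 2 ≠ q ^ (-2 * (h : ℤ)) * ζp ^ (-2 : ℤ)

/-- the Vandermonde product `∏_{1 ≤ b < a ≤ N} (x_a - x_b)` -/
def vdm (N : ℕ) (x : Fin N → ℂ) : ℂ := ∏ a : Fin N, ∏ b ∈ Finset.Iio a, (x a - x b)

/-- the `p×p` Baxter matrix `D_{τ,f}(λ)` -/
def dMat (l : ℕ) (q : ℂ) (tf ff : ℂ → ℂ) (lam : ℂ) : Matrix (Zp l) (Zp l) ℂ :=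
  Matrix.of fun j k =>
    if k = j then tf (q ^ j.val * lam)
    else if k = j + 1 then -ff ((q ^ j.val * lam)⁻¹)
    else if k = j - 1 then -ff (q ^ j.val * lam)
    else 0

/-- the coefficient `𝖺(λ) = 𝖺_+(λ) 𝖠_-(λ)` -/
def sfA (N : ℕ) (q s a0 αm βm ζp : ℂ) (P : BulkParams N) (lam : ℂ) : ℂ :=
  aPl q s ζp lam * AAm N q s a0 αm βm P lam

/-- the coefficient `ā(λ) = λ q^{-1/2} 𝖺(λ)` -/
def sfAbar (N : ℕ) (q s a0 αm βm ζp : ℂ) (P : BulkParams N) (lam : ℂ) : ℂ :=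
  lam / s * sfA N q s a0 αm βm ζp P lam

/-- the coefficient `𝖽(λ) = 𝖽_+(λ) 𝖣_-(λ)`, `𝖣_-(λ) = k(λ) 𝖠_-(q/λ)` -/
def sfD (N : ℕ) (q s a0 αm βm ζp : ℂ) (P : BulkParams N) (lam : ℂ) : ℂ :=
  dPl q s ζp lam * (kFun q lam * AAm N q s a0 αm βm P (q / lam))

/-- the asymptotic value `τ_∞` for the general transfer matrix -/
def tauInfGen (N : ℕ) (q : ℂ) (Bp Bm : Bdry) (P : BulkParams N) : ℂ :=
  Bp.κ * Bm.κ *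
    (Complex.exp (Bp.τ - Bm.τ) * (∏ n, (P.b n * P.d n / P.β n * (P.a n * P.c n / P.α n))) +
     Complex.exp (Bm.τ - Bp.τ) * (∏ n, (P.α n * P.β n))) /
    ((Bp.ζ - Bp.ζ⁻¹) * (Bm.ζ - Bm.ζ⁻¹))

/-- the asymptotic value `τ_∞` for the triangular `K_+` transfer matrix -/
def tauInfTri (N : ℕ) (Bp Bm : Bdry) (P : BulkParams N) : ℂ :=
  (-1 : ℂ) ^ N * Bp.κ * Bm.κ * Complex.exp (Bm.τ - Bp.τ) * (∏ n, (P.α n * P.β n)) /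
    ((Bp.ζ - Bp.ζ⁻¹) * (Bm.ζ - Bm.ζ⁻¹))

/-- the function `F(λ)` -/
def Ff (l N : ℕ) (q s : ℂ) (muP : Fin N → ℂ) (lam : ℂ) : ℂ :=
  ∏ n : Fin N,
    ((lam ^ (2 * l + 1) / (xiP N q s muP n 0) ^ (2 * l + 1) -
        (xiP N q s muP n 0) ^ (2 * l + 1) / lam ^ (2 * l + 1)) *
     (lam ^ (2 * l + 1) * (xiP N q s muP n 0) ^ (2 * l + 1) -
        (lam ^ (2 * l + 1) * (xiP N q s muP n 0) ^ (2 * l + 1))⁻¹))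

/-- the asymptotic value `ā_∞` -/
def abarInf (N : ℕ) (q αm βm : ℂ) (Bp Bm : Bdry) (P : BulkParams N) : ℂ :=
  (-1 : ℂ) ^ N * αm * βm * Bp.ζ * Bm.κ * (∏ n, (P.b n * P.c n)) /
    (q ^ (1 + N) * (Bp.ζ - Bp.ζ⁻¹) * (Bm.ζ - Bm.ζ⁻¹))

/-- the inhomogeneity `G(λ | x, y)` -/
def Gf (l N : ℕ) (q s a0 αm βm : ℂ) (Bp Bm : Bdry) (P : BulkParams N) (muP : Fin N → ℂ)
    (lam x y : ℂ) : ℂ :=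
  Ff l N q s muP lam *
    ((tauInfTri N Bp Bm P - q ^ (-(4 * (l : ℤ) * N)) * abarInf N q αm βm Bp Bm P) * x *
        ((lam / s - s / lam) * (s * lam - (s * lam)⁻¹) *
         (lam / (Complex.I * s) - Complex.I * s / lam) *
         (Complex.I * s * lam - (Complex.I * s * lam)⁻¹)) +
      (Complex.I - 1) * y * sfA N q s a0 αm βm Bp.ζ P (Complex.I * s) /
          (4 * Ff l N q s muP (Complex.I * s)) *
        ((lam * s - (lam * s)⁻¹) * (lam / s - (lam / s)⁻¹)))

/-- `τ` is an eigenvalue function of the family `T`, i.e. `τ ∈ Σ_T` -/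
def inSpec (l N : ℕ) (T : ℂ → Op l N) (tf : ℂ → ℂ) : Prop :=
  ∃ w : HIdx l N → ℂ, w ≠ 0 ∧ ∀ lam : ℂ, lam ≠ 0 → Matrix.mulVec (T lam) w = tf lam • w

/-- the joint eigenspace `E_τ` of the family `T` -/
def eigSp (l N : ℕ) (T : ℂ → Op l N) (tf : ℂ → ℂ) : Submodule ℂ (HIdx l N → ℂ) :=
  ⨅ lam : {x : ℂ // x ≠ 0},
    Module.End.eigenspace (Matrix.mulVecLin (T lam.1)) (tf lam.1)

/-- the admissible functional form of transfer matrix eigenvalues -/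
def admissible (N : ℕ) (q s tinf : ℂ) (Bp Bm : Bdry) (P : BulkParams N) (tf : ℂ → ℂ) : Prop :=
  (∃ Pol : Polynomial ℂ, Pol.degree ≤ ((N + 2 : ℕ) : WithBot ℕ) ∧
      Pol.coeff (N + 2) = tinf ∧
      ∀ lam : ℂ, lam ≠ 0 → tf lam = Pol.eval (lam ^ 2 + (lam ^ 2)⁻¹)) ∧
  tf s = (-1 : ℂ) ^ N * (q + q⁻¹) * dqM N q P 1 ∧
  tf (Complex.I * s) = (-1 : ℂ) ^ N * (q + q⁻¹) *
    ((Bp.ζ + Bp.ζ⁻¹) * (Bm.ζ + Bm.ζ⁻¹) / ((Bp.ζ - Bp.ζ⁻¹) * (Bm.ζ - Bm.ζ⁻¹))) *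
    dqM N q P Complex.I

/-- the separate state with coefficients `Q_a^{(h_a)}` in the right SoV basis -/
def sovVec (l N : ℕ) (q s a0 αm βm : ℂ) (P : BulkParams N) (Bm : Bdry) (muP : Fin N → ℂ)
    (j : Fin N → ℕ) (Q : Fin N → Zp l → ℂ) : HIdx l N → ℂ :=
  ∑ h : Fin N → Fin (2 * l + 1),
    ((∏ a, Q a ((h a : ℕ) : Zp l)) * vdm N (fun a => XVal N q s muP a ((h a : ℕ)))) •
      rightSoV l N q s a0 αm βm P Bm muP j (fun n => (h n : ℕ))

/-- the renormalized operator `B̂_-(λ)` -/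
def bHatOp (l N : ℕ) (q s : ℂ) (P : BulkParams N) (Bm : Bdry) (lam : ℂ) : Op l N :=
  ((Bm.ζ - Bm.ζ⁻¹) /
      (Bm.κ * Complex.exp Bm.τ * (lam ^ 2 / q - q / lam ^ 2) * ∏ n, (P.α n * P.β n))) •
    opB l N q s P Bm lam

/-- the state `|ω̄⟩` -/
def omegaBar (l N : ℕ) (q s a0 αm βm : ℂ) (P : BulkParams N) (Bm : Bdry) (muP : Fin N → ℂ)
    (j : Fin N → ℕ) : HIdx l N → ℂ :=
  ∑ h : Fin N → Fin (2 * l + 1),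
    (vdm N (fun a => XVal N q s muP a ((h a : ℕ)))) •
      rightSoV l N q s a0 αm βm P Bm muP j (fun n => (h n : ℕ))

/-- the recursively defined coefficients `t^{(h)}`:
`t^{(0)} = 1`, `t^{(1)} = F 0`, `t^{(h+2)} = F(h+1) t^{(h+1)} - G(h+1) t^{(h)}` -/
def tseq (F G : ℕ → ℂ) : ℕ → ℂ
  | 0 => 1
  | 1 => F 0
  | (h + 2) => F (h + 1) * tseq F G (h + 1) - G (h + 1) * tseq F G h

end SixV

namespace SixV

/-- the 6-vertex R-matrix on `ℂ² ⊗ ℂ²` -/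
def rMat (q lam : ℂ) : Matrix (Fin 2 × Fin 2) (Fin 2 × Fin 2) ℂ :=
  Matrix.of fun x y =>
    if x = y then (if x.1 = x.2 then q * lam - q⁻¹ * lam⁻¹ else lam - lam⁻¹)
    else if x.1 = y.2 ∧ x.2 = y.1 ∧ x.1 ≠ x.2 then q - q⁻¹ else 0

/-- `L₁(λ)`: the Lax matrix acting on the first `ℂ²` factor and on `ℂ^p` -/
def op1 (l : ℕ) (A : Matrix (Fin 2) (Fin 2) (Matrix (Zp l) (Zp l) ℂ)) :
    Matrix (Fin 2 × Fin 2 × Zp l) (Fin 2 × Fin 2 × Zp l) ℂ :=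
  Matrix.of fun x y => (if x.2.1 = y.2.1 then (1 : ℂ) else 0) * A x.1 y.1 x.2.2 y.2.2

/-- `L₂(λ)`: the Lax matrix acting on the second `ℂ²` factor and on `ℂ^p` -/
def op2 (l : ℕ) (A : Matrix (Fin 2) (Fin 2) (Matrix (Zp l) (Zp l) ℂ)) :
    Matrix (Fin 2 × Fin 2 × Zp l) (Fin 2 × Fin 2 × Zp l) ℂ :=
  Matrix.of fun x y => (if x.1 = y.1 then (1 : ℂ) else 0) * A x.2.1 y.2.1 x.2.2 y.2.2

/-- `R₁₂(λ) = R(λ) ⊗ Id_{ℂ^p}` -/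
def r12 (l : ℕ) (q lam : ℂ) :
    Matrix (Fin 2 × Fin 2 × Zp l) (Fin 2 × Fin 2 × Zp l) ℂ :=
  Matrix.of fun x y => (if x.2.2 = y.2.2 then (1 : ℂ) else 0) * rMat q lam (x.1, x.2.1) (y.1, y.2.1)

/-- the shift in `ℤ/pℤ` produced by the `(i,j)` entry of the Lax operator -/
def shL (l : ℕ) (i j : Fin 2) : Zp l := (i.val : Zp l) - (j.val : Zp l)

/-- the power of `q` by which the `(i,j)` entry shifts the clock eigenvalue -/
def shQ (q : ℂ) (i j : Fin 2) : ℂ := !![1, q⁻¹; q, 1] i j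

/-- matrix elements of the Lax operator as functions of the clock eigenvalue `z` -/
def gL (s pα pβ pa pb pc pd x : ℂ) (i j : Fin 2) (z : ℂ) : ℂ :=
  !![x * pα * z - pβ / x * z⁻¹, pa / s * z + s * pb * z⁻¹;
     s * pc * z + pd / s * z⁻¹, pa * pc / pα / x * z - pb * pd / pβ * x * z⁻¹] i j

lemma laxM_entry (l : ℕ) (q s pα pβ pa pb pc pd x : ℂ) (i j : Fin 2) (k m : Zp l) :
    laxM l q s pα pβ pa pb pc pd x i j k m =
      if k = m + shL l i j then gL s pα pβ pa pb pc pd x i j (q ^ m.val) else 0 := by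
  fin_cases i <;> fin_cases j <;>
    simp [laxM, shL, gL, vM, vMinv, uM, uMinv, Matrix.mul_apply, Matrix.diagonal_apply,
      Finset.sum_add_distrib, sub_eq_add_neg, mul_add]
  · by_cases h : k = m <;> simp [h]
  · by_cases h : k = m + -1 <;> simp [h]
  · by_cases h : k = m + 1 <;> simp [h]
  · by_cases h : k = m <;> simp [h]

lemma q_pow_add_one (l : ℕ) (q : ℂ) (hq : q ^ (2 * l + 1) = 1) (m : Zp l) :
    q ^ (m + 1).val = q * q ^ m.val := by
  have h : (m + 1 : Zp l) = ((m.val + 1 : ℕ) : Zp l) := by simp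
  rw [h, ZMod.val_natCast, ← pow_succ']
  conv_rhs => rw [← Nat.mod_add_div (m.val + 1) (2 * l + 1), pow_add, pow_mul, hq, one_pow, mul_one]

lemma q_pow_sh (l : ℕ) (q : ℂ) (hq : q ^ (2 * l + 1) = 1) (hq0 : q ≠ 0) (m : Zp l)
    (i j : Fin 2) : q ^ (m + shL l i j).val = shQ q i j * q ^ m.val := by
  fin_cases i <;> fin_cases j <;> simp [shL, shQ, q_pow_add_one l q hq]
  have := q_pow_add_one l q hq (m + -1)
  rw [neg_add_cancel_right] at this
  rw [this, inv_mul_cancel_left₀ hq0]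

lemma lax_mul_entry (l : ℕ) (q s pα pβ pa pb pc pd x y : ℂ) (hq : q ^ (2 * l + 1) = 1)
    (hq0 : q ≠ 0) (i j i' j' : Fin 2) (k m : Zp l) :
    ∑ n, laxM l q s pα pβ pa pb pc pd x i j k n * laxM l q s pα pβ pa pb pc pd y i' j' n m =
      if k = m + (shL l i' j' + shL l i j) then
        gL s pα pβ pa pb pc pd x i j (shQ q i' j' * q ^ m.val) *
          gL s pα pβ pa pb pc pd y i' j' (q ^ m.val) else 0 := by
  simp only [laxM_entry]
  rw [Finset.sum_eq_single (m + shL l i' j')]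
  · rw [q_pow_sh l q hq hq0]
    simp [add_assoc]
  · intro b _ hb
    simp [hb]
  · simp

lemma lhs_entry (l : ℕ) (q x : ℂ) (A B : Matrix (Fin 2) (Fin 2) (Matrix (Zp l) (Zp l) ℂ))
    (i j i' j' : Fin 2) (k m : Zp l) :
    (r12 l q x * op1 l A * op2 l B) (i, j, k) (i', j', m) =
      ∑ a, ∑ b, rMat q x (i, j) (a, b) * ∑ n, A a i' k n * B b j' n m := by
  simp only [Matrix.mul_apply, r12, op1, op2, Matrix.of_apply, Fintype.sum_prod_type,
    ite_mul, mul_ite, one_mul, zero_mul, mul_zero, Finset.sum_ite_eq, Finset.sum_ite_eq',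
    Finset.mem_univ, if_true, Finset.sum_const_zero]
  simp [Fin.sum_univ_two, Finset.sum_add_distrib, add_mul, Finset.mul_sum, mul_assoc]
  try ring

lemma rhs_entry (l : ℕ) (q x : ℂ) (A B : Matrix (Fin 2) (Fin 2) (Matrix (Zp l) (Zp l) ℂ))
    (i j i' j' : Fin 2) (k m : Zp l) :
    (op2 l B * op1 l A * r12 l q x) (i, j, k) (i', j', m) =
      ∑ a, ∑ b, (∑ n, B j b k n * A i a n m) * rMat q x (a, b) (i', j') := by
  simp only [Matrix.mul_apply, r12, op1, op2, Matrix.of_apply, Fintype.sum_prod_type,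
    ite_mul, mul_ite, one_mul, zero_mul, mul_zero, Finset.sum_ite_eq, Finset.sum_ite_eq',
    Finset.mem_univ, if_true, Finset.sum_const_zero]
  simp [Fin.sum_univ_two]

/-- the Bazhanov–Stroganov Lax operator satisfies the 6-vertex
Yang–Baxter equation on `ℂ² ⊗ ℂ² ⊗ ℂ^p`. -/
theorem yang_baxter_equation (l : ℕ) (hl : 1 ≤ l) (q s : ℂ)
    (hq : IsPrimitiveRoot q (2 * l + 1)) (hs : s ^ 2 = q)
    (pα pβ pa pb pc pd : ℂ) (hα : pα ≠ 0) (hβ : pβ ≠ 0) (ha : pa ≠ 0) (hb : pb ≠ 0)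
    (hc : pc ≠ 0) (hd : pd ≠ 0)
    (lam mu : ℂ) (hlam : lam ≠ 0) (hmu : mu ≠ 0) :
    r12 l q (lam / mu) * op1 l (laxM l q s pα pβ pa pb pc pd lam) *
        op2 l (laxM l q s pα pβ pa pb pc pd mu) =
      op2 l (laxM l q s pα pβ pa pb pc pd mu) * op1 l (laxM l q s pα pβ pa pb pc pd lam) *
        r12 l q (lam / mu) := by
  have hq0 : q ≠ 0 := hq.ne_zero (by omega)
  have hq1 := hq.pow_eq_one
  have hs0 : s ≠ 0 := by rintro rfl; simp at hs; exact hq0 hs.symm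
  ext ⟨i, j, k⟩ ⟨i', j', m⟩
  rw [lhs_entry, rhs_entry]
  simp only [lax_mul_entry l q s pα pβ pa pb pc pd _ _ hq1 hq0]
  have hz : q ^ m.val ≠ 0 := pow_ne_zero _ hq0
  generalize q ^ m.val = z at hz
  subst hs
  fin_cases i <;> fin_cases j <;> fin_cases i' <;> fin_cases j' <;>
    simp [Fin.sum_univ_two, rMat, shL, shQ, gL] <;>
    (try split_ifs) <;> (try simp) <;> (try field_simp) <;> (try ring)

end SixV
end
end

section
/- For all λ ∈ ℂˣ the quantum determinant of the monodromy matrix is central and factorizes: A(λq^{1/2})D(λq^{−1/2}) − B(λq^{1/2})C(λq^{−1/2}) = D(λq^{1/2})A(λq^{−1/2}) − C(λq^{1/2})B(λq^{−1/2}) = d_qM(λ)·Id_H, where d_qM(λ) = (−q)^N ∏_{n=1}^N (β_n a_n c_n/α_n)(λ^{−1} + q^{−1} b_n α_n λ/(a_n β_n))(λ^{−1} + q^{−1} d_n α_n λ/(c_n β_n)). -/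
open Matrix Polynomial Filter Topology

noncomputable section

namespace SixV

section helpers

/-- auxiliary-space adjugate -/
def tilde {R : Type*} [Ring R] (Y : Matrix (Fin 2) (Fin 2) R) : Matrix (Fin 2) (Fin 2) R :=
  Matrix.of ![![Y 1 1, -Y 0 1], ![-Y 1 0, Y 0 0]]

theorem tilde_mul {R : Type*} [Ring R] (X Y : Matrix (Fin 2) (Fin 2) R)
    (h : ∀ i j k m, X i j * Y k m = Y k m * X i j) :
    tilde (X * Y) = tilde Y * tilde X := by
  ext i j
  fin_cases i <;> fin_cases j <;>
    simp [tilde, Matrix.mul_apply, Fin.sum_univ_two, h] <;> abel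

theorem comm_list {R ι : Type*} [Ring R] (Y : ι → Matrix (Fin 2) (Fin 2) R) (x : R)
    (L : List ι) (h : ∀ n ∈ L, ∀ i j, x * Y n i j = Y n i j * x) :
    ∀ i j, x * (L.map Y).prod i j = (L.map Y).prod i j * x := by
  induction L with
  | nil => intro i j; by_cases hij : i = j <;> simp [Matrix.one_apply, hij]
  | cons n L ih =>
    intro i j
    have ih' := ih (fun m hm => h m (List.mem_cons_of_mem _ hm))
    have hn := h n List.mem_cons_self
    simp only [List.map_cons, List.prod_cons, Matrix.mul_apply, Finset.mul_sum, Finset.sum_mul]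
    refine Finset.sum_congr rfl fun k _ => ?_
    rw [← mul_assoc, hn, mul_assoc, ih', mul_assoc]

theorem qdet_list {R ι : Type*} [Ring R] [Algebra ℂ R]
    (X Y : ι → Matrix (Fin 2) (Fin 2) R) (d : ι → ℂ) (L : List ι) (hL : L.Nodup)
    (hc : ∀ n m, n ≠ m → ∀ i j k r, Y n i j * Y m k r = Y m k r * Y n i j)
    (h1 : ∀ n, X n * tilde (Y n) = d n • (1 : Matrix (Fin 2) (Fin 2) R)) :
    (L.map X).prod * tilde (L.map Y).prod =
      (L.map d).prod • (1 : Matrix (Fin 2) (Fin 2) R) := by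
  induction L with
  | nil =>
    ext i j
    fin_cases i <;> fin_cases j <;> simp [tilde]
  | cons n L ih =>
    have hn := List.nodup_cons.1 hL
    simp only [List.map_cons, List.prod_cons]
    rw [tilde_mul]
    · rw [mul_assoc, ← mul_assoc _ (tilde (List.map Y L).prod), ih hn.2, smul_mul_assoc, one_mul,
        mul_smul_comm, h1, smul_smul, mul_comm]
    · intro i j k m
      refine comm_list Y _ L (fun r hr a b => hc _ _ ?_ _ _ _ _) k m
      rintro rfl
      exact hn.1 hr

/-- Kronecker product over all sites -/
def kron (l N : ℕ) (F : Fin N → Matrix (Zp l) (Zp l) ℂ) : Op l N :=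
  Matrix.of fun x y => ∏ m, F m (x m) (y m)

theorem kron_mul (l N : ℕ) (F G : Fin N → Matrix (Zp l) (Zp l) ℂ) :
    kron l N F * kron l N G = kron l N (F * G) := by
  ext x y
  simp only [kron, Matrix.mul_apply, Matrix.of_apply, Pi.mul_apply, ← Finset.prod_mul_distrib]
  rw [Finset.prod_univ_sum, Fintype.piFinset_univ]

theorem site_eq (l N : ℕ) (n : Fin N) (A : Matrix (Zp l) (Zp l) ℂ) :
    site l N n A = kron l N (Pi.mulSingle n A) := by
  ext x y
  simp only [site, kron, Matrix.of_apply]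
  rw [← Finset.mul_prod_erase _ _ (Finset.mem_univ n), Pi.mulSingle_eq_same]
  congr 1
  refine Finset.prod_congr rfl fun m hm => ?_
  rw [Pi.mulSingle_eq_of_ne (Finset.ne_of_mem_erase hm), Matrix.one_apply]

theorem site_mul (l N : ℕ) (n : Fin N) (A B : Matrix (Zp l) (Zp l) ℂ) :
    site l N n A * site l N n B = site l N n (A * B) := by
  rw [site_eq, site_eq, site_eq, kron_mul, Pi.mulSingle_mul]

theorem site_comm (l N : ℕ) (n m : Fin N) (h : n ≠ m) (A B : Matrix (Zp l) (Zp l) ℂ) :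
    site l N n A * site l N m B = site l N m B * site l N n A := by
  rw [site_eq, site_eq, kron_mul, kron_mul]
  congr 1
  exact Pi.mulSingle_commute (f := fun _ : Fin N => Matrix (Zp l) (Zp l) ℂ) h A B

theorem site_one (l N : ℕ) (n : Fin N) : site l N n 1 = 1 := by
  rw [site_eq, Pi.mulSingle_one]
  ext x y
  simp only [kron, Matrix.of_apply, Pi.one_apply, Matrix.one_apply]
  rw [Finset.prod_ite_zero]
  simp [funext_iff]

/-- `site` as a ring homomorphism -/
def siteHom (l N : ℕ) (n : Fin N) : Matrix (Zp l) (Zp l) ℂ →+* Op l N where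
  toFun := site l N n
  map_one' := site_one l N n
  map_mul' A B := (site_mul l N n A B).symm
  map_zero' := by ext x y; simp [site]
  map_add' A B := by
    ext x y
    simp only [site, Matrix.of_apply, Matrix.add_apply, add_mul]

theorem siteHom_smul_one (l N : ℕ) (n : Fin N) (c : ℂ) :
    siteHom l N n (c • 1) = c • 1 := by
  rw [← map_one (siteHom l N n)]
  ext x y
  simp only [siteHom, RingHom.coe_mk, MonoidHom.coe_mk, OneHom.coe_mk, site, Matrix.of_apply,
    Matrix.smul_apply, smul_eq_mul, mul_assoc]

theorem siteHom_tilde (l N : ℕ) (n : Fin N) (c : ℂ)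
    (A B : Matrix (Fin 2) (Fin 2) (Matrix (Zp l) (Zp l) ℂ))
    (h : A * tilde B = c • 1) :
    (Matrix.of fun i j => siteHom l N n (A i j)) *
      tilde (Matrix.of fun i j => siteHom l N n (B i j)) = c • 1 := by
  ext1 i j
  have hij := congrArg (siteHom l N n) (congrFun (congrFun h i) j)
  fin_cases i <;> fin_cases j <;>
    simpa [tilde, Matrix.mul_apply, Fin.sum_univ_two, siteHom_smul_one] using hij

theorem uM_mul_uMinv (l : ℕ) : uM l * uMinv l = 1 := by
  ext i j
  simp [uM, uMinv, Matrix.mul_apply, Matrix.one_apply]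

theorem uMinv_mul_uM (l : ℕ) : uMinv l * uM l = 1 := by
  ext i j
  simp [uM, uMinv, Matrix.mul_apply, Matrix.one_apply]

theorem diag_uM (l : ℕ) (f : Zp l → ℂ) :
    Matrix.diagonal f * uM l = uM l * Matrix.diagonal (fun k => f (k - 1)) := by
  ext i j
  simp only [uM, Matrix.diagonal_mul, Matrix.mul_diagonal, Matrix.of_apply]
  split_ifs with h <;> simp [h]

theorem diag_uMinv (l : ℕ) (f : Zp l → ℂ) :
    Matrix.diagonal f * uMinv l = uMinv l * Matrix.diagonal (fun k => f (k + 1)) := by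
  ext i j
  simp only [uMinv, Matrix.diagonal_mul, Matrix.mul_diagonal, Matrix.of_apply]
  split_ifs with h <;> simp [h]

theorem chi_succ (l : ℕ) (q : ℂ) (hq : q ^ (2 * l + 1) = 1) (k : Zp l) :
    q ^ (k + 1).val = q * q ^ k.val := by
  rw [← pow_succ', ZMod.val_add, ZMod.val_one_eq_one_mod, Nat.add_mod_mod,
    ← pow_eq_pow_mod _ hq]

theorem chi_pred (l : ℕ) (q : ℂ) (hq : q ^ (2 * l + 1) = 1) (k : Zp l) :
    q ^ (k - 1).val = q⁻¹ * q ^ k.val := by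
  have h0 : q ≠ 0 := by rintro rfl; simp at hq
  have := chi_succ l q hq (k - 1)
  rw [sub_add_cancel] at this
  rw [this, inv_mul_cancel_left₀ h0]

theorem diag_comb (l : ℕ) (q x y : ℂ) :
    x • vM l q + y • vMinv l q =
      Matrix.diagonal fun k => x * q ^ k.val + y * (q ^ k.val)⁻¹ := by
  ext i j
  by_cases h : i = j <;> simp [vM, vMinv, h]

theorem diag_comb_sub (l : ℕ) (q x y : ℂ) :
    x • vM l q - y • vMinv l q =
      Matrix.diagonal fun k => x * q ^ k.val - y * (q ^ k.val)⁻¹ := by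
  ext i j
  by_cases h : i = j <;> simp [vM, vMinv, h]

theorem diag_const (l : ℕ) (c : ℂ) :
    c • (1 : Matrix (Zp l) (Zp l) ℂ) = Matrix.diagonal fun _ => c := by
  ext i j
  by_cases h : i = j <;> simp [h]

/-- local quantum determinant -/
def dloc (q α β a b c d lam : ℂ) : ℂ :=
  -q * (β * a * c / α * (lam⁻¹ + q⁻¹ * b * α * lam / (a * β)) *
    (lam⁻¹ + q⁻¹ * d * α * lam / (c * β)))

theorem lax_tilde (l : ℕ) (q s α β a b c d lam : ℂ) (hq : q ^ (2 * l + 1) = 1) (hs : s ^ 2 = q)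
    (hα : α ≠ 0) (hβ : β ≠ 0) (ha : a ≠ 0) (hc : c ≠ 0) (hlam : lam ≠ 0) :
    laxM l q s α β a b c d lam * tilde (laxM l q s α β a b c d (lam / q)) =
      dloc q α β a b c d lam • 1 := by
  have h0 : q ≠ 0 := by rintro rfl; simp at hq
  have hs0 : s ≠ 0 := by rintro rfl; simp at hs; exact h0 hs.symm
  have hx : ∀ k : Zp l, q ^ k.val ≠ 0 := fun k => pow_ne_zero _ h0
  have e1 : ∀ D : Matrix (Zp l) (Zp l) ℂ, uM l * (uMinv l * D) = D := by
    intro D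
    rw [← mul_assoc, uM_mul_uMinv, one_mul]
  have e2 : ∀ D : Matrix (Zp l) (Zp l) ℂ, uMinv l * (uM l * D) = D := by
    intro D
    rw [← mul_assoc, uMinv_mul_uM, one_mul]
  have e3 : ∀ (D : Matrix (Zp l) (Zp l) ℂ) (f : Zp l → ℂ),
      Matrix.diagonal f * (uM l * D) = uM l * (Matrix.diagonal (fun k => f (k - 1)) * D) := by
    intro D f
    rw [← mul_assoc, diag_uM, mul_assoc]
  have e4 : ∀ (D : Matrix (Zp l) (Zp l) ℂ) (f : Zp l → ℂ),
      Matrix.diagonal f * (uMinv l * D) =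
        uMinv l * (Matrix.diagonal (fun k => f (k + 1)) * D) := by
    intro D f
    rw [← mul_assoc, diag_uMinv, mul_assoc]
  ext1 i j
  fin_cases i <;> fin_cases j <;>
    simp only [tilde, laxM, dloc, Matrix.mul_apply, Fin.sum_univ_two, diag_comb, diag_comb_sub,
      Matrix.smul_apply, Matrix.of_apply, Matrix.cons_val_zero, Matrix.cons_val_one, Fin.isValue,
      Fin.zero_eta, Fin.mk_one, Matrix.one_apply_eq, ne_eq, zero_ne_one, one_ne_zero,
      not_false_eq_true, Matrix.one_apply_ne, smul_zero, diag_const, mul_neg, ← sub_eq_add_neg,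
      neg_add_eq_sub, e1, e2, e3, e4, mul_assoc (uM l), mul_assoc (uMinv l),
      Matrix.diagonal_mul_diagonal, Matrix.diagonal_sub, sub_eq_zero, chi_succ l q hq,
      chi_pred l q hq]
  · refine congrArg Matrix.diagonal (funext fun k => ?_)
    have hk := hx k
    generalize q ^ k.val = x at hk ⊢
    subst hs
    field_simp
    ring
  · refine congrArg (uM l * ·) (congrArg Matrix.diagonal (funext fun k => ?_))
    have hk := hx k
    generalize q ^ k.val = x at hk ⊢
    subst hs
    field_simp
  · refine congrArg (uMinv l * ·) (congrArg Matrix.diagonal (funext fun k => ?_))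
    have hk := hx k
    generalize q ^ k.val = x at hk ⊢
    subst hs
    field_simp
  · refine congrArg Matrix.diagonal (funext fun k => ?_)
    have hk := hx k
    generalize q ^ k.val = x at hk ⊢
    subst hs
    field_simp
    ring

end helpers

/-- the quantum determinant of the monodromy matrix is central and
factorizes into the scalar `d_qM(λ)` times the identity. -/
theorem quantum_determinant (l N : ℕ) (hl : 1 ≤ l) (hN : 1 ≤ N) (q s : ℂ)
    (hq : IsPrimitiveRoot q (2 * l + 1)) (hs : s ^ 2 = q)
    (P : BulkParams N) (hP : P.NonZero) :
    ∀ lam : ℂ, lam ≠ 0 →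
      mono l N q s P (lam * s) 0 0 * mono l N q s P (lam / s) 1 1 -
          mono l N q s P (lam * s) 0 1 * mono l N q s P (lam / s) 1 0 =
        dqM N q P lam • (1 : Op l N) ∧
      mono l N q s P (lam * s) 1 1 * mono l N q s P (lam / s) 0 0 -
          mono l N q s P (lam * s) 1 0 * mono l N q s P (lam / s) 0 1 =
        dqM N q P lam • (1 : Op l N) := by
  intro lam hlam
  have hq1 := hq.pow_eq_one
  have h0 : q ≠ 0 := by rintro rfl; simp at hq1
  have hs0 : s ≠ 0 := by rintro rfl; simp at hs; exact h0 hs.symm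
  have key : mono l N q s P (lam * s) * tilde (mono l N q s P (lam / s)) =
      dqM N q P lam • 1 := by
    have hd : dqM N q P lam = ((List.finRange N).reverse.map fun n =>
        dloc q (P.α n) (P.β n) (P.a n) (P.b n) (P.c n) (P.d n) lam).prod := by
      rw [((List.reverse_perm _).map _).prod_eq, ← Fin.prod_univ_def]
      simp only [dqM, dloc, Finset.prod_mul_distrib (f := fun _ => -q), Finset.prod_const,
        Finset.card_univ, Fintype.card_fin]
    rw [hd]
    refine qdet_list _ _ _ _ (List.nodup_reverse.2 (List.nodup_finRange N)) ?_ ?_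
    · intro n m hnm i j k r
      exact site_comm l N n m hnm _ _
    · intro n
      obtain ⟨hα, hβ, ha, -, hc, -⟩ := hP n
      have e1 : lam * s / s = lam := by field_simp
      have e2 : lam / s / s = lam / q := by rw [← hs]; field_simp
      rw [e1, e2]
      exact siteHom_tilde l N n _ _ _
        (lax_tilde l q s _ _ _ _ _ _ lam hq1 hs hα hβ ha hc hlam)
  constructor
  · have h := congrFun (congrFun key 0) 0
    simpa [tilde, Matrix.mul_apply, Fin.sum_univ_two, sub_eq_add_neg] using h
  · have h := congrFun (congrFun key 1) 1
    simpa [tilde, Matrix.mul_apply, Fin.sum_univ_two, sub_eq_add_neg, add_comm] using h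

end SixV
end
end
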